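/- arXiv:1803.06483 — 3 statements merged into one kernel-verified Lean document; each statement's English description precedes it below -/
import Mathlib

section
/- Assume 𝔟 > ω₁, i.e. for every family F of functions from ω to ω with |F| ≤ ℵ₁ there exists a single function g : ω → ω such that every f ∈ F satisfies f(n) ≤ g(n) for all but finitely many n. If X is a countable box-separable topological space and Y is a countable H-separable topological space, then the product X × Y is M-separable. -/
open Filter Topology

/-- A space is M-separable if for every sequence of dense sets one can pick finite
subsets whose union is dense. -/
def MSeparable (X : Type*) [TopologicalSpace X] : Prop :=
  ∀ D : ℕ → Set X, (∀ n, Dense (D n)) →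
    ∃ F : ℕ → Set X, (∀ n, F n ⊆ D n ∧ (F n).Finite) ∧ Dense (⋃ n, F n)

/-- A space is H-separable if for every sequence of dense sets one can pick finite
subsets meeting every nonempty open set for all but finitely many indices. -/
def HSeparable (X : Type*) [TopologicalSpace X] : Prop :=
  ∀ D : ℕ → Set X, (∀ n, Dense (D n)) →
    ∃ F : ℕ → Set X, (∀ n, F n ⊆ D n ∧ (F n).Finite) ∧
      ∀ O : Set X, IsOpen O → O.Nonempty → ∀ᶠ n in atTop, (O ∩ F n).Nonempty

/-- Box-separability. -/
def BoxSeparable (X : Type*) [TopologicalSpace X] : Prop :=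
  ∀ R : Set (Set X) → ℕ → Set X,
    (∀ 𝒰 : Set (Set X), 𝒰.Countable → (∀ U ∈ 𝒰, IsOpen U ∧ U.Nonempty) →
      (∀ n, (R 𝒰 n).Finite ∧ (R 𝒰 n).Nonempty) ∧
        ∀ U ∈ 𝒰, {n : ℕ | R 𝒰 n ⊆ U}.Infinite) →
    ∃ UU : Set (Set (Set X)),
      Cardinal.mk UU = Cardinal.aleph 1 ∧
      (∀ 𝒰 ∈ UU, 𝒰.Countable ∧ ∀ U ∈ 𝒰, IsOpen U ∧ U.Nonempty) ∧
      ∀ U : Set X, IsOpen U → U.Nonempty →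
        ∃ 𝒰 ∈ UU, {n : ℕ | R 𝒰 n ⊆ U}.Infinite

/-- A nonempty countable set can be enumerated so that each element occurs infinitely often. -/
lemma Set.Countable.exists_seq_infinite_fibers {α : Type*} {S : Set α} (hS : S.Countable)
    (hne : S.Nonempty) :
    ∃ u : ℕ → α, (∀ n, u n ∈ S) ∧ ∀ a ∈ S, {n | u n = a}.Infinite := by
  obtain ⟨f, rfl⟩ := hS.exists_eq_range hne
  refine ⟨fun n => f n.unpair.1, fun n => ⟨_, rfl⟩, ?_⟩
  rintro _ ⟨k, rfl⟩
  refine Set.infinite_of_injective_forall_mem (f := fun m => Nat.pair k m) ?_ ?_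
  · intro a b h
    simpa using h
  · intro m
    simp

/-- The part of a dense subset of a product lying over a nonempty open set of the first factor
has dense projection to the second factor. -/
lemma Dense.snd_image_inter_fst_preimage {X Y : Type*} [TopologicalSpace X] [TopologicalSpace Y]
    {D : Set (X × Y)} (hD : Dense D) {U : Set X} (hU : IsOpen U) (hne : U.Nonempty) :
    Dense (Prod.snd '' (D ∩ Prod.fst ⁻¹' U)) := by
  rw [dense_iff_inter_open]
  intro V hV hVne
  obtain ⟨p, ⟨hpU, hpV⟩, hpD⟩ := hD.inter_open_nonempty _ (hU.prod hV) (hne.prod hVne)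
  exact ⟨p.2, hpV, p, ⟨hpD, hpU⟩, rfl⟩

/-- If `Y` is H-separable, then from dense sets `D n` in `X × Y` one can pick finite nonempty
subsets whose second projections meet each nonempty open set eventually, and whose first
projections lie infinitely often in each member of a given countable family of open sets. -/
lemma HSeparable.exists_finite_subsets_prod {X Y : Type*} [TopologicalSpace X]
    [TopologicalSpace Y] [Nonempty X] [Nonempty Y] (hY : HSeparable Y) {D : ℕ → Set (X × Y)}
    (hD : ∀ n, Dense (D n)) {𝒰 : Set (Set X)} (hc : 𝒰.Countable)
    (ho : ∀ U ∈ 𝒰, IsOpen U ∧ U.Nonempty) :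
    ∃ G : ℕ → Set (X × Y), (∀ n, G n ⊆ D n ∧ (G n).Finite ∧ (G n).Nonempty) ∧
      (∀ U ∈ 𝒰, {n | Prod.fst '' G n ⊆ U}.Infinite) ∧
      ∀ V : Set Y, IsOpen V → V.Nonempty → ∀ᶠ n in atTop, ∃ p ∈ G n, p.2 ∈ V := by
  obtain ⟨u, hu, hinf⟩ :=
    (hc.insert Set.univ).exists_seq_infinite_fibers (Set.insert_nonempty _ _)
  have huo : ∀ n, IsOpen (u n) ∧ (u n).Nonempty := by
    intro n
    rcases hu n with h | h
    · rw [h]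
      exact ⟨isOpen_univ, Set.univ_nonempty⟩
    · exact ho _ h
  have hdense n := (hD n).snd_image_inter_fst_preimage (huo n).1 (huo n).2
  obtain ⟨L, hL, hLmeet⟩ := hY _ hdense
  have hlift n := Set.exists_subset_image_finite_and.1 ⟨L n, (hL n).1, (hL n).2, rfl⟩
  choose G hGsub hGfin hGL using hlift
  have hpt n := (hdense n).nonempty.of_image
  choose q hq using hpt
  refine ⟨fun n => insert (q n) (G n), fun n => ⟨?_, (hGfin n).insert _, Set.insert_nonempty _ _⟩,
    fun U hU => (hinf U (Set.mem_insert_of_mem _ hU)).mono ?_, fun V hV hVne => ?_⟩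
  · exact Set.insert_subset (hq n).1 fun p hp => (hGsub n hp).1
  · rintro n rfl _ ⟨p, rfl | hp, rfl⟩
    · exact (hq n).2
    · exact (hGsub n hp).2
  · filter_upwards [hLmeet V hV hVne] with n ⟨y, hyV, hyL⟩
    rw [hGL n] at hyL
    obtain ⟨p, hp, rfl⟩ := hyL
    exact ⟨p, Set.mem_insert_of_mem _ hp, hyV⟩

/-- Under 𝔟 > ω₁, the product of a countable box-separable space with a countable
H-separable space is M-separable. -/
theorem product_of_countable_box_separable_and_H_separable_is_M_separable
    {X Y : Type*} [TopologicalSpace X] [TopologicalSpace Y]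
    [Countable X] [Countable Y]
    (hb : ∀ F : Set (ℕ → ℕ), Cardinal.mk F ≤ Cardinal.aleph 1 →
      ∃ g : ℕ → ℕ, ∀ f ∈ F, ∀ᶠ n in atTop, f n ≤ g n)
    (hX : BoxSeparable X) (hY : HSeparable Y) :
    MSeparable (X × Y) := by
  intro D hD
  rcases isEmpty_or_nonempty (X × Y) with hempty | hne
  · exact ⟨fun _ => ∅, fun _ => ⟨Set.empty_subset _, Set.finite_empty⟩, fun p => isEmptyElim p⟩
  obtain ⟨_, _⟩ := nonempty_prod.1 hne
  have hsel : ∀ 𝒰 : Set (Set X), ∃ G : ℕ → Set (X × Y), 𝒰.Countable →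
      (∀ U ∈ 𝒰, IsOpen U ∧ U.Nonempty) →
      (∀ n, G n ⊆ D n ∧ (G n).Finite ∧ (G n).Nonempty) ∧
      (∀ U ∈ 𝒰, {n | Prod.fst '' G n ⊆ U}.Infinite) ∧
      ∀ V : Set Y, IsOpen V → V.Nonempty → ∀ᶠ n in atTop, ∃ p ∈ G n, p.2 ∈ V := by
    intro 𝒰
    by_cases h : 𝒰.Countable ∧ ∀ U ∈ 𝒰, IsOpen U ∧ U.Nonempty
    · obtain ⟨G, hG⟩ := hY.exists_finite_subsets_prod hD h.1 h.2
      exact ⟨G, fun _ _ => hG⟩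
    · exact ⟨fun _ => ∅, fun h₁ h₂ => absurd ⟨h₁, h₂⟩ h⟩
  choose G hG using hsel
  obtain ⟨UU, hcard, hUU, hcover⟩ := hX (fun 𝒰 n => Prod.fst '' G 𝒰 n) fun 𝒰 hc ho =>
    ⟨fun n => ⟨((hG 𝒰 hc ho).1 n).2.1.image _, ((hG 𝒰 hc ho).1 n).2.2.image _⟩,
      (hG 𝒰 hc ho).2.1⟩
  obtain ⟨e, he⟩ := exists_injective_nat (X × Y)
  have hbound : ∀ 𝒰 n, ∃ m, 𝒰 ∈ UU → ∀ p ∈ G 𝒰 n, e p ≤ m := by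
    intro 𝒰 n
    by_cases h : 𝒰 ∈ UU
    · obtain ⟨m, hm⟩ := (((hG 𝒰 (hUU 𝒰 h).1 (hUU 𝒰 h).2).1 n).2.1.image e).bddAbove
      exact ⟨m, fun _ p hp => hm ⟨p, hp, rfl⟩⟩
    · exact ⟨0, fun h' => absurd h' h⟩
  choose f hf using hbound
  obtain ⟨g, hg⟩ := hb (f '' UU) (by
    have h := Cardinal.mk_image_le_lift (f := f) (s := UU)
    rw [hcard] at h
    simpa using h)
  refine ⟨fun n => {p ∈ D n | e p ≤ g n}, fun n => ⟨fun p hp => hp.1, ?_⟩, ?_⟩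
  · exact ((Set.finite_Iic (g n)).preimage he.injOn).subset fun p hp => hp.2
  rw [dense_iff_inter_open]
  rintro W hW ⟨⟨x, y⟩, hxy⟩
  obtain ⟨U, V, hU, hV, hxU, hyV, hUV⟩ := isOpen_prod_iff.1 hW x y hxy
  obtain ⟨𝒰, h𝒰, hinf⟩ := hcover U hU ⟨x, hxU⟩
  have hG𝒰 := hG 𝒰 (hUU 𝒰 h𝒰).1 (hUU 𝒰 h𝒰).2
  obtain ⟨n, hnU, ⟨p, hp, hpV⟩, hng⟩ := ((Nat.frequently_atTop_iff_infinite.2 hinf).and_eventually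
    ((hG𝒰.2.2 V hV ⟨y, hyV⟩).and (hg _ ⟨𝒰, h𝒰, rfl⟩))).exists
  exact ⟨p, hUV ⟨hnU ⟨p, hp, rfl⟩, hpV⟩,
    Set.mem_iUnion.2 ⟨n, (hG𝒰.1 n).1 hp, (hf 𝒰 n h𝒰 p hp).trans hng⟩⟩
end

section
/- Every dense subspace of an H-separable topological space is H-separable. -/
open Filter Topology

/-- Every dense subspace of an H-separable space is H-separable. -/
theorem HSeparable.of_dense_subspace {X : Type*} [TopologicalSpace X]
    (hX : HSeparable X) (D : Set X) (hD : Dense D) :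
    HSeparable D := by
  intro E hE
  obtain ⟨G, hG, hmeet⟩ := hX (fun n => Subtype.val '' E n)
    fun n => hD.denseRange_val.dense_image continuous_subtype_val (hE n)
  refine ⟨fun n => Subtype.val ⁻¹' G n, fun n => ⟨fun x hx => ?_, ?_⟩, fun O hO hne => ?_⟩
  · obtain ⟨y, hy, hyx⟩ := (hG n).1 hx
    exact Subtype.val_injective hyx ▸ hy
  · exact (hG n).2.preimage Subtype.val_injective.injOn
  · obtain ⟨U, hU, rfl⟩ := isOpen_induced_iff.mp hO
    obtain ⟨x, hx⟩ := hne
    filter_upwards [hmeet U hU ⟨x, hx⟩] with n hn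
    obtain ⟨y, hyU, hyG⟩ := hn
    obtain ⟨z, -, rfl⟩ := (hG n).1 hyG
    exact ⟨z, hyU, hyG⟩
end

section
/- Suppose that the product of any two countable H-separable topological spaces is M-separable. Then for any two H-separable topological spaces X and Y, if the product X × Y is hereditarily separable, then X × Y is M-separable. -/
open Filter Topology

/-- H-separability passes to the domain of an inducing map with dense range; in particular it is
inherited by dense subspaces. -/
theorem HSeparable.of_isInducing_denseRange {A X : Type*} [TopologicalSpace A]
    [TopologicalSpace X] {f : A → X} (hf : IsInducing f) (hd : DenseRange f)
    (hX : HSeparable X) : HSeparable A := by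
  intro D hD
  obtain ⟨F, hF, hFO⟩ := hX (fun n => f '' D n) fun n => hd.dense_image hf.continuous (hD n)
  have hG : ∀ n, ∃ G : Set A, G ⊆ D n ∧ G.Finite ∧ f '' G = F n := fun n =>
    (Set.exists_subset_image_finite_and (p := fun t => t = F n)).1 ⟨F n, (hF n).1, (hF n).2, rfl⟩
  choose G hGD hGfin hGF using hG
  refine ⟨G, fun n => ⟨hGD n, hGfin n⟩, fun O hO hne => ?_⟩
  obtain ⟨U, hU, rfl⟩ := hf.isOpen_iff.1 hO
  obtain ⟨a, ha⟩ := hne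
  filter_upwards [hFO U hU ⟨f a, ha⟩] with n hn
  obtain ⟨x, hxU, hxF⟩ := hn
  rw [← hGF n] at hxF
  obtain ⟨b, hb, rfl⟩ := hxF
  exact ⟨b, hxU, hb⟩

/-- The preimage under an inducing map of a dense subset of its range is dense. -/
theorem Dense.preimage_of_isInducing {A X : Type*} [TopologicalSpace A] [TopologicalSpace X]
    {f : A → X} (hf : IsInducing f) {E : Set X} (hE : Dense E) (hEf : E ⊆ Set.range f) :
    Dense (f ⁻¹' E) := by
  rw [hf.dense_iff]
  intro a
  rw [Set.image_preimage_eq_of_subset hEf]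
  exact hE (f a)

/-- It suffices to test M-separability on sequences of dense subsets of the range of an inducing
map from an M-separable space. -/
theorem MSeparable.exists_finite_of_isInducing {A X : Type*} [TopologicalSpace A]
    [TopologicalSpace X] {f : A → X} (hf : IsInducing f) (hA : MSeparable A)
    {E : ℕ → Set X} (hE : ∀ n, Dense (E n)) (hEf : ∀ n, E n ⊆ Set.range f) :
    ∃ F : ℕ → Set X, (∀ n, F n ⊆ E n ∧ (F n).Finite) ∧ Dense (⋃ n, F n) := by
  obtain ⟨F, hF, hFd⟩ := hA (fun n => f ⁻¹' E n) fun n => (hE n).preimage_of_isInducing hf (hEf n)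
  refine ⟨fun n => f '' F n, fun n => ⟨Set.image_subset_iff.2 (hF n).1, (hF n).2.image f⟩, ?_⟩
  rw [← Set.image_iUnion]
  have hd : DenseRange f := (hE 0).mono (hEf 0)
  exact hd.dense_image hf.continuous hFd

/-- A dense subset that is separable as a subspace contains a countable dense subset. -/
theorem Dense.exists_countable_dense_subset_of_separableSpace {X : Type*} [TopologicalSpace X]
    {D : Set X} (hD : Dense D) [TopologicalSpace.SeparableSpace D] :
    ∃ E ⊆ D, E.Countable ∧ Dense E := by
  obtain ⟨t, htc, htd⟩ := TopologicalSpace.exists_countable_dense D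
  exact ⟨Subtype.val '' t, Subtype.coe_image_subset D t, htc.image _,
    hD.denseRange_val.dense_image continuous_subtype_val htd⟩

/-- A countable subset of a space is the range of an inducing map from a countable space living
in any prescribed universe. -/
theorem Set.Countable.exists_isInducing_range_eq.{u, v} {X : Type v} [TopologicalSpace X]
    {s : Set X} (hs : s.Countable) :
    ∃ (A : Type u) (_ : TopologicalSpace A) (_ : Countable A) (f : A → X),
      IsInducing f ∧ Set.range f = s := by
  have : Countable s := hs.to_subtype
  have : Small.{u} s := Countable.toSmall s
  let f : Shrink.{u} s → X := fun a => ((equivShrink s).symm a : X)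
  refine ⟨Shrink.{u} s, TopologicalSpace.induced f inferInstance,
    (equivShrink s).symm.injective.countable, f, @IsInducing.mk _ _ (_) _ _ rfl, ?_⟩
  have := (equivShrink.{u} s).symm.surjective.range_comp (Subtype.val : s → X)
  rwa [Subtype.range_val] at this

/-- If the product of any two countable H-separable spaces is M-separable, then the
product of any two H-separable spaces is M-separable provided it is hereditarily
separable. -/
theorem product_hSeparable_mSeparable_of_hereditarily_separable
    (h : ∀ (A : Type*) [TopologicalSpace A] [Countable A],
         ∀ (B : Type*) [TopologicalSpace B] [Countable B],
         HSeparable A → HSeparable B → MSeparable (A × B)) :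
    ∀ (X : Type*) [TopologicalSpace X], ∀ (Y : Type*) [TopologicalSpace Y],
      HSeparable X → HSeparable Y →
      (∀ S : Set (X × Y), TopologicalSpace.SeparableSpace S) →
      MSeparable (X × Y) := by
  intro X _ Y _ hX hY hsep D hD
  rcases isEmpty_or_nonempty (X × Y) with hXY | hXY
  · exact ⟨fun _ => ∅, fun n => ⟨Set.empty_subset _, Set.finite_empty⟩, fun p => hXY.elim p⟩
  obtain ⟨hXne, hYne⟩ := nonempty_prod.1 hXY
  choose E hED hEc hEd using fun n =>
    have := hsep (D n)
    (hD n).exists_countable_dense_subset_of_separableSpace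
  have hUc : (⋃ n, E n).Countable := Set.countable_iUnion hEc
  have hUd : Dense (⋃ n, E n) := (hEd 0).mono (Set.subset_iUnion E 0)
  obtain ⟨A, _, _, f, hf, hfr⟩ := (hUc.image Prod.fst).exists_isInducing_range_eq
  obtain ⟨B, _, _, g, hg, hgr⟩ := (hUc.image Prod.snd).exists_isInducing_range_eq
  have hfd : DenseRange f := by
    rw [DenseRange, hfr]
    exact Prod.fst_surjective.denseRange.dense_image continuous_fst hUd
  have hgd : DenseRange g := by
    rw [DenseRange, hgr]
    exact Prod.snd_surjective.denseRange.dense_image continuous_snd hUd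
  have hEr : ∀ n, E n ⊆ Set.range (Prod.map f g) := fun n p hp => by
    have hpU : p ∈ ⋃ n, E n := Set.mem_iUnion_of_mem n hp
    rw [Set.range_prodMap, hfr, hgr]
    exact ⟨Set.mem_image_of_mem _ hpU, Set.mem_image_of_mem _ hpU⟩
  obtain ⟨F, hF, hFd⟩ := (h A B (hX.of_isInducing_denseRange hf hfd)
    (hY.of_isInducing_denseRange hg hgd)).exists_finite_of_isInducing (hf.prodMap hg) hEd hEr
  exact ⟨F, fun n => ⟨(hF n).1.trans (hED n), (hF n).2⟩, hFd⟩
end
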